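/- Let ξ ∈ ℝ with 0 < ξ < α, and let u ∈ C²([0,R)) be the solution of the Cauchy problem M⁺(u'') + g(u) = 0, u(0) = ξ, u'(0) = 0 on its maximal interval of existence [0,R). Then there exists a first zero r₁ ∈ (0,R) of u (i.e. u(r₁) = 0 and u > 0 on [0,r₁)), u is strictly decreasing on (0,r₁], and u'(r₁) = −√(2 G(ξ)/λ). -/

import Mathlib

open Set Filter Topology

/-- Picard-Lindelöf for a locally Lipschitz autonomous vector field. -/
theorem LocallyLipschitz.exists_forall_mem_Ioo_hasDerivAt
    {E : Type*} [NormedAddCommGroup E] [NormedSpace ℝ E] [CompleteSpace E]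
    {f : E → E} (hf : LocallyLipschitz f) (t₀ : ℝ) (x₀ : E) :
    ∃ γ : ℝ → E, γ t₀ = x₀ ∧ ∃ ε > (0 : ℝ),
      ∀ t ∈ Ioo (t₀ - ε) (t₀ + ε), HasDerivAt γ (f (γ t)) t := by
  obtain ⟨K, s, hs, hl⟩ := hf x₀
  have hs' : s ∩ {x | ‖f x‖ < ‖f x₀‖ + 1} ∈ 𝓝 x₀ :=
    inter_mem hs (hf.continuous.norm.continuousAt.eventually_lt_const (by simp))
  obtain ⟨a, ha, has⟩ := Metric.nhds_basis_closedBall.mem_iff.mp hs'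
  have hL : 0 < ‖f x₀‖ + 1 := by positivity
  set ε := a / (‖f x₀‖ + 1) with hε
  have hε0 : 0 < ε := by positivity
  have hpl : IsPicardLindelof (fun _ ↦ f) (tmin := t₀ - ε) (tmax := t₀ + ε)
      ⟨t₀, by simp [hε0.le]⟩ x₀ (.mk a ha.le) 0 (.mk (‖f x₀‖ + 1) hL.le) K := by
    apply IsPicardLindelof.of_time_independent
    · exact fun x hx ↦ (has hx).2.le
    · exact hl.mono fun x hx ↦ (has hx).1
    · simp only [add_sub_cancel_left, sub_sub_cancel, max_self, NNReal.coe_mk, NNReal.coe_zero,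
        sub_zero, hε]
      exact (mul_div_cancel₀ a hL.ne').le
  obtain ⟨γ, h0, hγ⟩ := hpl.exists_eq_forall_mem_Icc_hasDerivWithinAt₀
  exact ⟨γ, h0, ε, hε0, fun t ht ↦
    (hγ t (Ioo_subset_Icc_self ht)).hasDerivAt (Icc_mem_nhds ht.1 ht.2)⟩

/-- Gluing two functions at `R` preserves differentiability when the one-sided limits of values and
derivatives match. -/
theorem hasDerivAt_ite_lt {f f' w : ℝ → ℝ} {c R b : ℝ} (hc : c < R)
    (hf : ∀ r ∈ Ioo c R, HasDerivAt f (f' r) r)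
    (hfl : Tendsto f (𝓝[<] R) (𝓝 (w R))) (hfl' : Tendsto f' (𝓝[<] R) (𝓝 b))
    (hw : HasDerivAt w b R) :
    HasDerivAt (fun r ↦ if r < R then f r else w r) b R := by
  set v : ℝ → ℝ := fun r ↦ if r < R then f r else w r with hv
  have hvf : ∀ r < R, v =ᶠ[𝓝 r] f := fun r hr ↦ by
    filter_upwards [Iio_mem_nhds hr] with x hx using if_pos hx
  have hvd : ∀ r ∈ Ioo c R, HasDerivAt v (f' r) r := fun r hr ↦
    (hf r hr).congr_of_eventuallyEq (hvf r hr.2)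
  have hmem : Ioo c R ∈ 𝓝[<] R := Ioo_mem_nhdsLT hc
  have hvR : v R = w R := if_neg (lt_irrefl R)
  have hl : HasDerivWithinAt v b (Iic R) R := by
    refine hasDerivWithinAt_Iic_of_tendsto_deriv (s := Ioo c R)
      (fun r hr ↦ (hvd r hr).differentiableAt.differentiableWithinAt) ?_ hmem ?_
    · have : Tendsto v (𝓝[<] R) (𝓝 (v R)) := by
        rw [hvR]
        refine hfl.congr' ?_
        filter_upwards [self_mem_nhdsWithin] with x hx using (if_pos hx).symm
      exact this.mono_left (nhdsWithin_mono _ fun x hx ↦ hx.2)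
    · refine hfl'.congr' ?_
      filter_upwards [hmem] with x hx using (hvd x hx).deriv.symm
  have hr : HasDerivWithinAt v b (Ici R) R :=
    hw.hasDerivWithinAt.congr (fun x hx ↦ if_neg (not_lt.mpr hx)) hvR
  simpa [Iic_union_Ici] using hl.union hr

/-- A solution of `u'' = h u` with limits of `u` and `u'` at `R` extends beyond `R`. -/
theorem exists_extension_of_tendsto {h : ℝ → ℝ} (hh : LocallyLipschitz h)
    {u p : ℝ → ℝ} {c R a b : ℝ} (hc : c < R)
    (hu : ∀ r ∈ Ioo c R, HasDerivAt u (p r) r)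
    (hp : ∀ r ∈ Ioo c R, HasDerivAt p (h (u r)) r)
    (ha : Tendsto u (𝓝[<] R) (𝓝 a)) (hb : Tendsto p (𝓝[<] R) (𝓝 b)) :
    ∃ ε > (0 : ℝ), ∃ v q : ℝ → ℝ, (∀ r < R, v r = u r) ∧
      ∀ r ∈ Ioo c (R + ε), HasDerivAt v (q r) r ∧ HasDerivAt q (h (v r)) r := by
  have hF : LocallyLipschitz (fun z : ℝ × ℝ ↦ (z.2, h z.1)) :=
    LipschitzWith.prod_snd.locallyLipschitz.prodMk
      (hh.comp LipschitzWith.prod_fst.locallyLipschitz)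
  obtain ⟨γ, hγ0, ε, hε, hγ⟩ := hF.exists_forall_mem_Ioo_hasDerivAt R (a, b)
  have h1 : ∀ t ∈ Ioo (R - ε) (R + ε), HasDerivAt (fun r ↦ (γ r).1) (γ t).2 t := fun t ht ↦
    (hγ t ht).fst
  have h2 : ∀ t ∈ Ioo (R - ε) (R + ε), HasDerivAt (fun r ↦ (γ r).2) (h (γ t).1) t := fun t ht ↦
    (hγ t ht).snd
  have hR : R ∈ Ioo (R - ε) (R + ε) := ⟨by linarith, by linarith⟩
  refine ⟨ε, hε, fun r ↦ if r < R then u r else (γ r).1,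
    fun r ↦ if r < R then p r else (γ r).2, fun r hr ↦ if_pos hr, fun r hr ↦ ?_⟩
  rcases lt_trichotomy r R with hrR | rfl | hrR
  · have hev : ∀ᶠ x in 𝓝 r, x < R := Iio_mem_nhds hrR
    simp only [if_pos hrR]
    refine ⟨(hu r ⟨hr.1, hrR⟩).congr_of_eventuallyEq ?_,
      (hp r ⟨hr.1, hrR⟩).congr_of_eventuallyEq ?_⟩
    · filter_upwards [hev] with x hx using if_pos hx
    · filter_upwards [hev] with x hx using if_pos hx
  · have ha' : a = (γ r).1 := by rw [hγ0]
    have hb' : b = (γ r).2 := by rw [hγ0]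
    simp only [lt_irrefl, if_false]
    refine ⟨hasDerivAt_ite_lt hc hu (ha' ▸ ha) (hb' ▸ hb) (h1 r hR), ?_⟩
    refine hasDerivAt_ite_lt hc hp (hb' ▸ hb) ?_ (h2 r hR)
    exact (hh.continuous.tendsto _).comp (ha' ▸ ha)
  · have hev : ∀ᶠ x in 𝓝 r, R < x := Ioi_mem_nhds hrR
    have hr' : r ∈ Ioo (R - ε) (R + ε) := ⟨by linarith, hr.2⟩
    simp only [if_neg hrR.not_gt]
    refine ⟨(h1 r hr').congr_of_eventuallyEq ?_, (h2 r hr').congr_of_eventuallyEq ?_⟩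
    · filter_upwards [hev] with x hx using if_neg hx.not_gt
    · filter_upwards [hev] with x hx using if_neg hx.not_gt

/-- The Pucci equation `M⁺(y) + z = 0` solved for `y`. -/
theorem pucci_add_eq_zero_iff {lam Lam : ℝ} (hlam : 0 < lam) (hle : lam ≤ Lam) (y z : ℝ) :
    (if 0 ≤ y then Lam * y else lam * y) + z = 0 ↔ y = -max (lam⁻¹ * z) (Lam⁻¹ * z) := by
  have hLam : 0 < Lam := hlam.trans_le hle
  have hinv : Lam⁻¹ ≤ lam⁻¹ := inv_anti₀ hlam hle
  have hi : 0 < lam⁻¹ := inv_pos.mpr hlam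
  have hI : 0 < Lam⁻¹ := inv_pos.mpr hLam
  rcases le_or_gt z 0 with hz | hz
  · rw [max_eq_right (by nlinarith)]
    constructor
    · intro h
      split_ifs at h with hy
      · rw [show z = -(Lam * y) by linarith]; field_simp
      · nlinarith
    · rintro rfl
      rw [if_pos (by nlinarith)]; field_simp; ring
  · rw [max_eq_left (by nlinarith)]
    constructor
    · intro h
      split_ifs at h with hy
      · nlinarith
      · rw [show z = -(lam * y) by linarith]; field_simp
    · rintro rfl
      rw [if_neg (by nlinarith)]; field_simp; ring

theorem strictAntiOn_of_second_deriv_neg {u p p' : ℝ → ℝ} {T : ℝ}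
    (hu : ContinuousOn u (Icc 0 T)) (hp : ContinuousOn p (Icc 0 T)) (hp0 : p 0 = 0)
    (hup : ∀ r ∈ Ioo 0 T, HasDerivAt u (p r) r) (hpp : ∀ r ∈ Ioo 0 T, HasDerivAt p (p' r) r)
    (hneg : ∀ r ∈ Ioo 0 T, p' r < 0) :
    StrictAntiOn p (Icc 0 T) ∧ StrictAntiOn u (Icc 0 T) := by
  have h1 : StrictAntiOn p (Icc 0 T) := by
    refine strictAntiOn_of_deriv_neg (convex_Icc 0 T) hp fun r hr ↦ ?_
    rw [interior_Icc] at hr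
    rw [(hpp r hr).deriv]
    exact hneg r hr
  refine ⟨h1, strictAntiOn_of_deriv_neg (convex_Icc 0 T) hu fun r hr ↦ ?_⟩
  rw [interior_Icc] at hr
  rw [(hup r hr).deriv, ← hp0]
  exact h1 ⟨le_rfl, (hr.1.trans hr.2).le⟩ (Ioo_subset_Icc_self hr) hr.1

/-- As long as it stays positive, a solution of the Pucci initial value problem is strictly
decreasing and concave, and its energy is conserved. -/
theorem pucci_solution_of_pos {lam Lam α ξ T : ℝ} (hlam : 0 < lam) (hle : lam ≤ Lam) (hξα : ξ < α)
    {g : ℝ → ℝ} (hgc : Continuous g) (hg : ∀ t, 0 < t → t < α → 0 < g t)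
    {u p : ℝ → ℝ} (hT : 0 < T)
    (hu : ContinuousOn u (Icc 0 T)) (hp : ContinuousOn p (Icc 0 T)) (hu0 : u 0 = ξ) (hp0 : p 0 = 0)
    (hup : ∀ r ∈ Ioo 0 T, HasDerivAt u (p r) r)
    (hpp : ∀ r ∈ Ioo 0 T, HasDerivAt p (-max (lam⁻¹ * g (u r)) (Lam⁻¹ * g (u r))) r)
    (hpos : ∀ r ∈ Ico 0 T, 0 < u r) :
    StrictAntiOn p (Icc 0 T) ∧ StrictAntiOn u (Icc 0 T) ∧
      lam / 2 * p T ^ 2 + ∫ s in (0 : ℝ)..u T, g s = ∫ s in (0 : ℝ)..ξ, g s := by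
  have hi : 0 < lam⁻¹ := inv_pos.mpr hlam
  have hneg : ∀ r, 0 < u r → u r < α → -max (lam⁻¹ * g (u r)) (Lam⁻¹ * g (u r)) < 0 :=
    fun r h0 h1 ↦ neg_lt_zero.mpr (lt_max_of_lt_left (mul_pos hi (hg _ h0 h1)))
  have hanti : ∀ t ∈ Ioc 0 T, (∀ r ∈ Ico 0 t, u r < α) →
      StrictAntiOn p (Icc 0 t) ∧ StrictAntiOn u (Icc 0 t) := by
    intro t ht hlt
    have hsub : Icc 0 t ⊆ Icc 0 T := Icc_subset_Icc_right ht.2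
    have hsub' : Ioo 0 t ⊆ Ioo 0 T := Ioo_subset_Ioo_right ht.2
    exact strictAntiOn_of_second_deriv_neg (hu.mono hsub) (hp.mono hsub) hp0
      (fun r hr ↦ hup r (hsub' hr)) (fun r hr ↦ hpp r (hsub' hr))
      fun r hr ↦ hneg r (hpos r (Ioo_subset_Ico_self (hsub' hr))) (hlt r (Ioo_subset_Ico_self hr))
  have hlt : ∀ r ∈ Icc 0 T, u r < α := by
    by_contra! hne
    obtain ⟨r, hr, hrα⟩ := hne
    have hcpt : IsCompact (Icc 0 T ∩ u ⁻¹' Ici α) :=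
      isCompact_Icc.of_isClosed_subset (hu.preimage_isClosed_of_isClosed isClosed_Icc isClosed_Ici)
        inter_subset_left
    obtain ⟨t, ⟨htI, htα⟩, htl⟩ := hcpt.exists_isLeast ⟨r, hr, hrα⟩
    have ht0 : 0 < t := by
      refine htI.1.lt_of_ne ?_
      rintro rfl
      rw [mem_preimage, hu0] at htα
      exact absurd hξα (not_lt.mpr htα)
    have := (hanti t ⟨ht0, htI.2⟩ fun r hr ↦ by
      by_contra! h
      exact absurd hr.2 (not_lt.mpr (htl ⟨⟨hr.1, hr.2.le.trans htI.2⟩, h⟩))).2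
      ⟨le_rfl, ht0.le⟩ ⟨ht0.le, le_rfl⟩ ht0
    rw [hu0] at this
    exact absurd (this.trans hξα) (not_lt.mpr htα)
  obtain ⟨h1, h2⟩ := hanti T ⟨hT, le_rfl⟩ fun r hr ↦ hlt r (Ico_subset_Icc_self hr)
  refine ⟨h1, h2, ?_⟩
  have hGd : ∀ x, HasDerivAt (fun x ↦ ∫ s in (0 : ℝ)..x, g s) (g x) x := fun x ↦
    hgc.integral_hasStrictDerivAt 0 x |>.hasDerivAt
  have hGc : Continuous (fun x ↦ ∫ s in (0 : ℝ)..x, g s) :=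
    continuous_iff_continuousAt.mpr fun x ↦ (hGd x).continuousAt
  obtain ⟨r, hr, hrs⟩ := exists_hasDerivAt_eq_slope
    (fun r ↦ lam / 2 * p r ^ 2 + ∫ s in (0 : ℝ)..u r, g s) (fun _ ↦ 0) hT
    ((continuousOn_const.mul (hp.pow 2)).add (hGc.comp_continuousOn hu)) (by
      intro r hr
      have hgr : 0 < g (u r) :=
        hg _ (hpos r (Ioo_subset_Ico_self hr)) (hlt r (Ioo_subset_Icc_self hr))
      have hpr := hpp r hr
      rw [max_eq_left (by gcongr)] at hpr
      have hG' : HasDerivAt (fun r ↦ ∫ s in (0 : ℝ)..u r, g s) (g (u r) * p r) r :=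
        (hGd (u r)).comp r (hup r hr)
      refine (((hpr.pow 2).const_mul (lam / 2)).add hG').congr_deriv ?_
      simp only [Nat.cast_ofNat]
      field_simp
      ring)
  rw [eq_div_iff (by linarith), zero_mul] at hrs
  simp only [hp0, hu0] at hrs
  linarith

theorem pucci_1d_plus_first_zero
    (lam Lam : ℝ) (hlam : 0 < lam) (hlamLam : lam ≤ Lam)
    (g : ℝ → ℝ) (hg1 : LocallyLipschitz g)
    (hg2 : ∀ t, g (-t) = - g t)
    (α : ℝ) (hα : 0 < α)
    (hg3pos : ∀ t, 0 < t → t < α → 0 < g t)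
    (hg3neg : ∀ t, α < t → g t < 0)
    (G : ℝ → ℝ) (hG : ∀ t, G t = ∫ s in (0:ℝ)..t, g s)
    (ξ : ℝ) (hξ0 : 0 < ξ) (hξα : ξ < α)
    (R : EReal) (hR : 0 < R)
    (u : ℝ → ℝ)
    (hu : ContDiffOn ℝ 2 u {r : ℝ | 0 ≤ r ∧ (r : EReal) < R})
    (hode : ∀ r : ℝ, 0 ≤ r → (r : EReal) < R →
      (if 0 ≤ deriv (deriv u) r then Lam * deriv (deriv u) r
        else lam * deriv (deriv u) r) + g (u r) = 0)
    (hu0 : u 0 = ξ) (hu'0 : deriv u 0 = 0)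
    (hmax : ¬ ∃ (R' : EReal) (v : ℝ → ℝ), R < R' ∧
      ContDiffOn ℝ 2 v {r : ℝ | 0 ≤ r ∧ (r : EReal) < R'} ∧
      (∀ r : ℝ, 0 ≤ r → (r : EReal) < R' →
        (if 0 ≤ deriv (deriv v) r then Lam * deriv (deriv v) r
        else lam * deriv (deriv v) r) + g (v r) = 0) ∧
      v 0 = ξ ∧ deriv v 0 = 0 ∧
      (∀ r : ℝ, 0 ≤ r → (r : EReal) < R → v r = u r))
 :
    ∃ r₁ : ℝ, 0 < r₁ ∧ (r₁ : EReal) < R ∧ u r₁ = 0 ∧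
      (∀ r, 0 ≤ r → r < r₁ → 0 < u r) ∧
      StrictAntiOn u (Set.Ioc 0 r₁) ∧
      deriv u r₁ = - Real.sqrt (2 * G ξ / lam) := by
  have hLam : 0 < Lam := hlam.trans_le hlamLam
  have hgc : Continuous g := hg1.continuous
  have hg0 : g 0 = 0 := by have := hg2 0; rw [neg_zero] at this; linarith
  set h : ℝ → ℝ := fun x ↦ -max (lam⁻¹ * g x) (Lam⁻¹ * g x) with hh
  have hhL : LocallyLipschitz h := by
    have hm : ∀ c : ℝ, LocallyLipschitz fun x ↦ c * g x := fun c ↦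
      (contDiff_const.mul contDiff_id : ContDiff ℝ 1 fun y : ℝ ↦ c * y).locallyLipschitz.comp hg1
    exact LipschitzWith.id.neg.locallyLipschitz.comp ((hm lam⁻¹).max (hm Lam⁻¹))
  have hode' : ∀ r : ℝ, 0 ≤ r → (r : EReal) < R → deriv (deriv u) r = h (u r) := fun r h0 hr ↦
    (pucci_add_eq_zero_iff hlam hlamLam _ _).mp (hode r h0 hr)
  have hopen : IsOpen {r : ℝ | 0 < r ∧ (r : EReal) < R} :=
    isOpen_Ioi.inter (isOpen_Iio.preimage continuous_coe_real_ereal)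
  have hder := (contDiffOn_succ_iff_deriv_of_isOpen (n := 1) hopen).mp
    (hu.mono fun r hr ↦ ⟨hr.1.le, hr.2⟩)
  have hup : ∀ r : ℝ, 0 < r → (r : EReal) < R → HasDerivAt u (deriv u r) r := fun r h0 hr ↦
    (hder.1.differentiableAt (hopen.mem_nhds ⟨h0, hr⟩)).hasDerivAt
  have hpp : ∀ r : ℝ, 0 < r → (r : EReal) < R → HasDerivAt (deriv u) (h (u r)) r := by
    intro r h0 hr
    rw [← hode' r h0.le hr]
    exact ((hder.2.2.differentiableOn one_ne_zero).differentiableAt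
      (hopen.mem_nhds ⟨h0, hr⟩)).hasDerivAt
  have hcoe : ∀ {s t : ℝ}, s ≤ t → (t : EReal) < R → (s : EReal) < R := fun hst ht ↦
    (EReal.coe_le_coe_iff.mpr hst).trans_lt ht
  have hp0 : ContinuousAt (deriv u) 0 := by
    refine (differentiableAt_of_deriv_ne_zero ?_).continuousAt
    rw [hode' 0 le_rfl (by simpa using hR), hu0]
    have : 0 < lam⁻¹ * g ξ := mul_pos (inv_pos.mpr hlam) (hg3pos ξ hξ0 hξα)
    exact (neg_lt_zero.mpr (lt_max_of_lt_left this)).ne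
  have hpc : ∀ r : ℝ, 0 ≤ r → (r : EReal) < R → ContinuousAt (deriv u) r := by
    intro r h0 hr
    rcases h0.eq_or_lt with rfl | h0
    · exact hp0
    · exact (hpp r h0 hr).continuousAt
  have huc : ∀ T : ℝ, (T : EReal) < R → ContinuousOn u (Icc 0 T) := fun T hT ↦
    hu.continuousOn.mono fun r hr ↦ ⟨hr.1, hcoe hr.2 hT⟩
  have key : ∀ T : ℝ, 0 < T → (T : EReal) < R → (∀ r ∈ Ico 0 T, 0 < u r) →
      StrictAntiOn (deriv u) (Icc 0 T) ∧ StrictAntiOn u (Icc 0 T) ∧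
        lam / 2 * deriv u T ^ 2 + G (u T) = G ξ := by
    intro T hT hTR hpos
    rw [hG, hG]
    exact pucci_solution_of_pos hlam hlamLam hξα hgc hg3pos hT (huc T hTR)
      (fun r hr ↦ (hpc r hr.1 (hcoe hr.2 hTR)).continuousWithinAt) hu0 hu'0
      (fun r hr ↦ hup r hr.1 (hcoe hr.2.le hTR)) (fun r hr ↦ hpp r hr.1 (hcoe hr.2.le hTR)) hpos
  have hex : ∃ t : ℝ, 0 ≤ t ∧ (t : EReal) < R ∧ u t ≤ 0 := by
    by_contra! hpos
    have key' : ∀ T : ℝ, 0 < T → (T : EReal) < R → _ := fun T hT hTR ↦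
      key T hT hTR fun r hr ↦ hpos r hr.1 (hcoe hr.2.le hTR)
    induction R using EReal.rec with
    | bot => exact absurd hR (by simp)
    | top =>
      have hT : ∀ T : ℝ, (T : EReal) < ⊤ := EReal.coe_lt_top
      set c := deriv u 1 with hc
      have hcneg : c < 0 := by
        rw [← hu'0]
        exact (key' 1 one_pos (hT 1)).1 ⟨le_rfl, zero_le_one⟩ ⟨zero_le_one, le_rfl⟩ one_pos
      have hu1 : 0 < u 1 := hpos 1 zero_le_one (hT 1)
      set t := 1 + u 1 / (-c) with ht
      have hd : 0 < u 1 / (-c) := div_pos hu1 (by linarith)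
      have h1t : 1 < t := by linarith
      obtain ⟨s, hs, hst⟩ := exists_hasDerivAt_eq_slope u (deriv u) h1t
        ((huc t (hT t)).mono (Icc_subset_Icc_left zero_le_one))
        fun x hx ↦ hup x (one_pos.trans hx.1) (hT x)
      have hsc : deriv u s < c :=
        (key' s (by linarith [hs.1]) (hT s)).1 ⟨zero_le_one, hs.1.le⟩
          ⟨by linarith [hs.1], le_rfl⟩ hs.1
      rw [hst, div_lt_iff₀ (by linarith)] at hsc
      have : c * (t - 1) = -u 1 := by
        rw [ht]; field_simp [hcneg.ne]; ring
      linarith [hpos t (by linarith) (hT t)]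
    | coe R =>
      have hR0 : 0 < R := by exact_mod_cast hR
      have hlt : ∀ {r : ℝ}, r < R → (r : EReal) < (R : EReal) := fun hr ↦ by exact_mod_cast hr
      have hne : (Ioo 0 R).Nonempty := nonempty_Ioo.mpr hR0
      have hua : AntitoneOn u (Ioo 0 R) := fun x hx y hy hxy ↦
        (key' y hy.1 (hlt hy.2)).2.1.antitoneOn ⟨hx.1.le, hxy⟩ ⟨hy.1.le, le_rfl⟩ hxy
      have hpa : AntitoneOn (deriv u) (Ioo 0 R) := fun x hx y hy hxy ↦
        (key' y hy.1 (hlt hy.2)).1.antitoneOn ⟨hx.1.le, hxy⟩ ⟨hy.1.le, le_rfl⟩ hxy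
      have hul := hua.tendsto_nhdsWithin_Ioo_left hne ⟨0, by
        rintro _ ⟨x, hx, rfl⟩
        exact (hpos x hx.1.le (hlt hx.2)).le⟩
      have hpl := hpa.tendsto_nhdsWithin_Ioo_left hne ⟨-Real.sqrt (2 * G ξ / lam), by
        rintro _ ⟨x, hx, rfl⟩
        obtain ⟨-, h2, h3⟩ := key' x hx.1 (hlt hx.2)
        have hux : u x < α := by
          refine lt_trans ?_ hξα
          rw [← hu0]
          exact h2 ⟨le_rfl, hx.1.le⟩ ⟨hx.1.le, le_rfl⟩ hx.1
        have hGnn : 0 ≤ G (u x) := by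
          rw [hG]
          refine intervalIntegral.integral_nonneg (hpos x hx.1.le (hlt hx.2)).le fun s hs ↦ ?_
          rcases hs.1.eq_or_lt with rfl | hs0
          · exact hg0.ge
          · exact (hg3pos s hs0 (hs.2.trans_lt hux)).le
        refine neg_le_of_abs_le (Real.abs_le_sqrt ?_)
        rw [le_div_iff₀ hlam]
        linarith⟩
      obtain ⟨ε, hε, v, q, hvu, hv⟩ := exists_extension_of_tendsto hhL hR0
        (fun r hr ↦ hup r hr.1 (hlt hr.2)) (fun r hr ↦ hpp r hr.1 (hlt hr.2)) hul hpl
      have hlt' : ∀ {r : ℝ}, (r : EReal) < ((R + ε : ℝ) : EReal) → r < R + ε := fun hr ↦ by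
        exact_mod_cast hr
      have hev : ∀ {r : ℝ}, r < R → v =ᶠ[𝓝 r] u := fun hr ↦ by
        filter_upwards [Iio_mem_nhds hr] with x hx using hvu x hx
      have hvd : ∀ r ∈ Ioo 0 (R + ε), deriv v r = q r := fun r hr ↦ (hv r hr).1.deriv
      have hvdd : ∀ r ∈ Ioo 0 (R + ε), HasDerivAt (deriv v) (h (v r)) r := fun r hr ↦
        (hv r hr).2.congr_of_eventuallyEq <| by
          filter_upwards [isOpen_Ioo.mem_nhds hr] with x hx using hvd x hx
      have hvdiff : DifferentiableOn ℝ v (Ioo 0 (R + ε)) := fun r hr ↦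
        (hv r hr).1.differentiableAt.differentiableWithinAt
      have hv2 : ContDiffOn ℝ 2 v (Ioo 0 (R + ε)) := by
        refine (contDiffOn_succ_iff_deriv_of_isOpen (n := 1) isOpen_Ioo).mpr
          ⟨hvdiff, by simp, ?_⟩
        refine (contDiffOn_succ_iff_deriv_of_isOpen (n := 0) isOpen_Ioo).mpr
          ⟨fun r hr ↦ (hvdd r hr).differentiableAt.differentiableWithinAt, by simp, ?_⟩
        refine contDiffOn_zero.mpr ?_
        exact (hhL.continuous.comp_continuousOn hvdiff.continuousOn).congr
          fun r hr ↦ (hvdd r hr).deriv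
      refine hmax ⟨((R + ε : ℝ) : EReal), v, by exact_mod_cast (by linarith : R < R + ε), ?_, ?_,
        by rw [hvu 0 hR0, hu0], by rw [(hev hR0).deriv_eq, hu'0],
        fun r _ hr ↦ hvu r (by exact_mod_cast hr)⟩
      · rintro r ⟨hr0, hr⟩
        rcases hr0.eq_or_lt with rfl | hr0
        · refine ((hu 0 ⟨le_rfl, hR⟩).mono_of_mem_nhdsWithin ?_).congr_of_eventuallyEq
            ((hev hR0).filter_mono nhdsWithin_le_nhds) (hvu 0 hR0)
          filter_upwards [self_mem_nhdsWithin, mem_nhdsWithin_of_mem_nhds (Iio_mem_nhds hR0)]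
            with x hx hx' using ⟨hx.1, hlt hx'⟩
        · exact (hv2.contDiffAt (Ioo_mem_nhds hr0 (hlt' hr))).contDiffWithinAt
      · intro r hr0 hr
        rcases lt_or_ge r R with hrR | hrR
        · rw [(hev hrR).deriv.deriv_eq, hvu r hrR]
          exact hode r hr0 (hlt hrR)
        · rw [pucci_add_eq_zero_iff hlam hlamLam]
          exact (hvdd r ⟨hR0.trans_le hrR, hlt' hr⟩).deriv
  obtain ⟨T, hT0, hTR, hTu⟩ := hex
  have hcpt : IsCompact (Icc 0 T ∩ u ⁻¹' Iic 0) :=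
    isCompact_Icc.of_isClosed_subset
      ((huc T hTR).preimage_isClosed_of_isClosed isClosed_Icc isClosed_Iic) inter_subset_left
  obtain ⟨t, ⟨htI, htu⟩, htl⟩ := hcpt.exists_isLeast ⟨T, ⟨hT0, le_rfl⟩, hTu⟩
  have htu : u t ≤ 0 := htu
  have ht0 : 0 < t := by
    refine htI.1.lt_of_ne ?_
    rintro rfl
    linarith
  have htR : (t : EReal) < R := hcoe htI.2 hTR
  have hpos : ∀ r ∈ Ico 0 t, 0 < u r := by
    intro r hr
    by_contra! hle
    exact absurd hr.2 (not_lt.mpr (htl ⟨⟨hr.1, hr.2.le.trans htI.2⟩, hle⟩))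
  have htz : u t = 0 := by
    obtain ⟨s, hs, hs0⟩ := intermediate_value_Icc' ht0.le (huc t htR)
      (show (0 : ℝ) ∈ Icc (u t) (u 0) from ⟨htu, by rw [hu0]; exact hξ0.le⟩)
    rcases hs.2.eq_or_lt with rfl | hst
    · exact hs0
    · exact absurd hs0 (hpos s ⟨hs.1, hst⟩).ne'
  obtain ⟨h1, h2, h3⟩ := key t ht0 htR hpos
  refine ⟨t, ht0, htR, htz, fun r h0 hr ↦ hpos r ⟨h0, hr⟩, h2.mono Ioc_subset_Icc_self, ?_⟩
  have hpt : deriv u t < 0 := by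
    rw [← hu'0]
    exact h1 ⟨le_rfl, ht0.le⟩ ⟨ht0.le, le_rfl⟩ ht0
  have hG0 : G 0 = 0 := by rw [hG, intervalIntegral.integral_same]
  rw [htz, hG0, add_zero] at h3
  rw [← h3, show 2 * (lam / 2 * deriv u t ^ 2) / lam = deriv u t ^ 2 by field_simp,
    Real.sqrt_sq_eq_abs, abs_of_neg hpt, neg_neg]
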